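/- Let (x_k), (v_k) be generated by the modified symplectic Euler scheme, and suppose the parameters satisfy (1) Δ₂√s/(1−√(μs)) ≤ 1/L; (2) (√s/2)(1+Δ₁) ≤ Δ₂ ≤ √s(1+Δ₁); (3) 1+Δ₁ ≥ 1/(1−√(μs)). Then the Lyapunov function is nonincreasing, E(k+1) ≤ E(k) for all k ≥ 0, and consequently f(x_k) − f(x*) − (Δ₂√s/(2(1−√(μs))))‖∇f(x_k)‖² ≤ ((1−√(μs))/(1+Δ₁))·(1+√(μs))^{−k}·E(0) for all k ≥ 0. -/

import Mathlib

open scoped InnerProductSpace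

section GradientInequalities

variable {H : Type*} [NormedAddCommGroup H] [InnerProductSpace ℝ H] [CompleteSpace H]
  {f : H → ℝ}

lemma hasDerivAt_add_smul_of_differentiable (hf : Differentiable ℝ f) (x d : H) (t : ℝ) :
    HasDerivAt (fun t : ℝ ↦ f (x + t • d)) ⟪gradient f (x + t • d), d⟫_ℝ t := by
  have hline : HasDerivAt (fun t : ℝ ↦ x + t • d) d t := by
    simpa using ((hasDerivAt_id t).smul_const d).const_add x
  exact (hf (x + t • d)).hasGradientAt.hasFDerivAt.comp_hasDerivAt t hline

/-- First-order lower bound for differentiable strongly convex functions. -/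
lemma StrongConvexOn.add_inner_gradient_add_le {m : ℝ} (hf : Differentiable ℝ f)
    (hsc : StrongConvexOn Set.univ m f) (x y : H) :
    f x + ⟪gradient f x, y - x⟫_ℝ + m / 2 * ‖y - x‖ ^ 2 ≤ f y := by
  have hconv := (strongConvexOn_iff_convex.mp hsc).comp_affineMap (AffineMap.lineMap x y)
  have hcomp : (fun z ↦ f z - m / 2 * ‖z‖ ^ 2) ∘ AffineMap.lineMap x y =
      fun t : ℝ ↦ f (x + t • (y - x)) - m / 2 * ‖x + t • (y - x)‖ ^ 2 := by
    funext t
    simp [AffineMap.lineMap_apply, add_comm]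
  rw [hcomp, Set.preimage_univ] at hconv
  have hline : HasDerivAt (fun t : ℝ ↦ x + t • (y - x)) (y - x) 0 := by
    simpa using ((hasDerivAt_id (0 : ℝ)).smul_const (y - x)).const_add x
  have hderiv := (hasDerivAt_add_smul_of_differentiable hf x (y - x) 0).sub
    (hline.norm_sq.const_mul (m / 2))
  have hslope := hconv.le_slope_of_hasDerivAt (Set.mem_univ 0) (Set.mem_univ 1) one_pos hderiv
  simp only [slope_def_field, zero_smul, add_zero, one_smul, add_sub_cancel, sub_zero,
    div_one] at hslope
  have hnorm : ‖y‖ ^ 2 = ‖x‖ ^ 2 + 2 * ⟪x, y - x⟫_ℝ + ‖y - x‖ ^ 2 := by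
    rw [← norm_add_sq_real, add_sub_cancel]
  rw [hnorm] at hslope
  linarith

/-- The descent lemma for functions with Lipschitz gradient. -/
lemma le_add_inner_gradient_add_of_lipschitz {L : ℝ} (hf : Differentiable ℝ f)
    (hL : ∀ x y, ‖gradient f x - gradient f y‖ ≤ L * ‖x - y‖) (x d : H) :
    f (x + d) ≤ f x + ⟪gradient f x, d⟫_ℝ + L / 2 * ‖d‖ ^ 2 := by
  have hφ := hasDerivAt_add_smul_of_differentiable hf x d
  have hB (t : ℝ) : HasDerivAt
      (fun t : ℝ ↦ f x + t * ⟪gradient f x, d⟫_ℝ + L / 2 * ‖d‖ ^ 2 * t ^ 2)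
      (⟪gradient f x, d⟫_ℝ + L * ‖d‖ ^ 2 * t) t := by
    refine ((((hasDerivAt_id t).mul_const ⟪gradient f x, d⟫_ℝ).const_add (f x)).add
      ((hasDerivAt_pow 2 t).const_mul (L / 2 * ‖d‖ ^ 2))).congr_deriv ?_
    norm_num
    ring
  have h := image_le_of_deriv_right_le_deriv_boundary (a := 0) (b := 1)
    (fun t _ ↦ (hφ t).continuousAt.continuousWithinAt) (fun t _ ↦ (hφ t).hasDerivWithinAt)
    (by simp) (fun t _ ↦ (hB t).continuousAt.continuousWithinAt)
    (fun t _ ↦ (hB t).hasDerivWithinAt) ?_ (Set.right_mem_Icc.mpr zero_le_one)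
  · simpa using h
  · intro t ht
    have hlip := hL (x + t • d) x
    rw [add_sub_cancel_left, norm_smul, Real.norm_of_nonneg ht.1] at hlip
    have hinner := (real_inner_le_norm (gradient f (x + t • d) - gradient f x) d).trans
      (mul_le_mul_of_nonneg_right hlip (norm_nonneg d))
    rw [inner_sub_left] at hinner
    linarith

/-- Convex functions with Lipschitz gradient satisfy the interpolation inequality. -/
lemma ConvexOn.add_inner_gradient_add_norm_gradient_sub_le {L : ℝ} (hf : Differentiable ℝ f)
    (hconv : ConvexOn ℝ Set.univ f) (hLpos : 0 < L)
    (hL : ∀ x y, ‖gradient f x - gradient f y‖ ≤ L * ‖x - y‖) (x y : H) :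
    f x + ⟪gradient f x, y - x⟫_ℝ + 1 / L / 2 * ‖gradient f y - gradient f x‖ ^ 2 ≤ f y := by
  set w := gradient f y - gradient f x with hw
  have hlow := StrongConvexOn.add_inner_gradient_add_le hf (strongConvexOn_zero.mpr hconv) x
    (y + (-(1 / L)) • w)
  have hupp := le_add_inner_gradient_add_of_lipschitz hf hL y ((-(1 / L)) • w)
  have hsplit : y + (-(1 / L)) • w - x = (y - x) + (-(1 / L)) • w := by abel
  have hsq : ⟪gradient f y, w⟫_ℝ - ⟪gradient f x, w⟫_ℝ = ‖w‖ ^ 2 := by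
    rw [← inner_sub_left, ← hw, real_inner_self_eq_norm_sq]
  have hnorm : L / 2 * ‖(-(1 / L)) • w‖ ^ 2 = 1 / L / 2 * ‖w‖ ^ 2 := by
    rw [norm_smul, mul_pow, Real.norm_eq_abs, sq_abs]
    field_simp
  rw [hsplit, inner_add_right, real_inner_smul_right] at hlow
  rw [hnorm, real_inner_smul_right] at hupp
  linear_combination hlow + hupp - 1 / L * hsq

end GradientInequalities

section SymplecticEuler

variable {H : Type*} [NormedAddCommGroup H] [InnerProductSpace ℝ H]

lemma norm_add_smul_add_smul_sq (α β γ : ℝ) (u y g : H) :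
    ‖α • u + β • y + γ • g‖ ^ 2 = α ^ 2 * ‖u‖ ^ 2 + β ^ 2 * ‖y‖ ^ 2 + γ ^ 2 * ‖g‖ ^ 2
      + 2 * (α * β * ⟪u, y⟫_ℝ + α * γ * ⟪u, g⟫_ℝ + β * γ * ⟪g, y⟫_ℝ) := by
  rw [norm_add_sq_real, norm_add_sq_real]
  simp only [inner_add_left, real_inner_smul_left, real_inner_smul_right, norm_smul, mul_pow,
    Real.norm_eq_abs, sq_abs, real_inner_comm y g]
  ring

/-- One step of the energy estimate, where `u`, `y`, `g` are the new velocity, the new position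
relative to the minimizer and the new gradient, `g'` is the old gradient, and `F`, `F'` are the
new and old function value gaps. -/
lemma symplectic_energy_step {m r a b F F' : ℝ} {u y g g' : H} (hm : 0 < m) (hr : 0 < r)
    (hmr : m * r < 1) (h2 : r / 2 * a ≤ b) (h2' : b ≤ r * a) (h3 : 1 ≤ a * (1 - m * r))
    (hF : F ≤ ⟪g, y⟫_ℝ - m ^ 2 / 2 * ‖y‖ ^ 2) (hgy : 0 ≤ ⟪g, y⟫_ℝ)
    (hF' : F - r / (1 - m * r) *
        ((1 + m * r) * ⟪u, g⟫_ℝ + (r * a + b) * ‖g‖ ^ 2 - b * ⟪g, g'⟫_ℝ)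
      + b * r / (1 - m * r) / 2 * ‖g' - g‖ ^ 2 ≤ F') :
    (1 + m * r) * (a / (1 - m * r) * (F - b * r / (2 * (1 - m * r)) * ‖g‖ ^ 2)
        + 1 / 2 * ‖(1 / (1 - m * r)) • u + (m / (1 - m * r)) • y + (b / (1 - m * r)) • g‖ ^ 2)
      ≤ a / (1 - m * r) * (F' - b * r / (2 * (1 - m * r)) * ‖g'‖ ^ 2)
        + 1 / 2 * ‖((1 + m * r) / (1 - m * r)) • u + (m / (1 - m * r)) • y
          + ((r * a + b) / (1 - m * r)) • g‖ ^ 2 := by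
  have hc : 0 < 1 - m * r := by linarith
  have ha : 0 < a := by
    by_contra! hneg
    nlinarith
  have hq : 0 < m * r := by positivity
  have hra : 0 < r * a := by positivity
  have hb : 0 ≤ b := by linarith
  have hrem : 0 ≤ m * r * (1 + m * r) * ‖u‖ ^ 2
      + m * r * m ^ 2 * (a * (1 - m * r) - 1) * ‖y‖ ^ 2
      + 2 * (m * r) * m * (r * a - b) * ⟪g, y⟫_ℝ
      + (m * r * b * (r * a - b) + r * a * (2 * b - r * a)) * ‖g‖ ^ 2 := by
    have hy : 0 ≤ a * (1 - m * r) - 1 := by linarith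
    have hd : 0 ≤ r * a - b := by linarith
    have hg : 0 ≤ 2 * b - r * a := by linarith
    positivity
  rw [norm_sub_sq_real, real_inner_comm g g'] at hF'
  rw [norm_add_smul_add_smul_sq, norm_add_smul_add_smul_sq]
  have hF'_slack := mul_nonneg (div_nonneg ha.le hc.le) (sub_nonneg.mpr hF')
  have hF_slack := mul_nonneg (div_nonneg (mul_nonneg ha.le hq.le) hc.le) (sub_nonneg.mpr hF)
  have hrem_slack := div_nonneg hrem (by positivity : 0 ≤ 2 * (1 - m * r) ^ 2)
  rw [← sub_nonneg]
  refine (add_nonneg (add_nonneg hF'_slack hF_slack) hrem_slack).trans_eq ?_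
  field_simp
  ring

end SymplecticEuler


/-- for the modified symplectic Euler scheme under conditions (1)–(3), the
Lyapunov function is nonincreasing and the shifted function values converge at the stated
rate. -/
theorem modified_symplectic_lyapunov_and_rate
    {H : Type*} [NormedAddCommGroup H] [InnerProductSpace ℝ H] [CompleteSpace H]
    (f : H → ℝ) (μ L : ℝ) (hμ : 0 < μ)
    (hf : ContDiff ℝ 1 f) (hsc : StrongConvexOn Set.univ μ f)
    (hL : ∀ x y, ‖gradient f x - gradient f y‖ ≤ L * ‖x - y‖)
    (xs : H) (hmin : ∀ y, f xs ≤ f y)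
    (s : ℝ) (hs : 0 < s) (hμs : Real.sqrt (μ * s) < 1)
    (Δ₁ Δ₂ : ℝ) (hΔ₁ : 0 ≤ Δ₁) (hΔ₂ : 0 ≤ Δ₂)
    (x v : ℕ → H)
    (hx : ∀ k, (Real.sqrt s)⁻¹ • (x (k + 1) - x k) = v k)
    (hv : ∀ k, (Real.sqrt s)⁻¹ • (v (k + 1) - v k) =
      -(Real.sqrt μ • (v (k + 1) + v k)) - (1 + Δ₁) • gradient f (x (k + 1))
        - (Δ₂ / Real.sqrt s) • (gradient f (x (k + 1)) - gradient f (x k)))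
    (E : ℕ → ℝ)
    (hE : ∀ k, E k = (1 + Real.sqrt (μ * s)) ^ k *
      ((1 + Δ₁) / (1 - Real.sqrt (μ * s)) *
          (f (x k) - f xs
            - Δ₂ * Real.sqrt s / (2 * (1 - Real.sqrt (μ * s))) * ‖gradient f (x k)‖ ^ 2) +
        (1 / 2) * ‖v k + (Real.sqrt μ / (1 - Real.sqrt (μ * s))) • (x (k + 1) - xs)
          + (Δ₂ / (1 - Real.sqrt (μ * s))) • gradient f (x k)‖ ^ 2))
    (h1 : Δ₂ * Real.sqrt s / (1 - Real.sqrt (μ * s)) ≤ 1 / L)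
    (h2 : Real.sqrt s / 2 * (1 + Δ₁) ≤ Δ₂) (h2' : Δ₂ ≤ Real.sqrt s * (1 + Δ₁))
    (h3 : 1 / (1 - Real.sqrt (μ * s)) ≤ 1 + Δ₁) :
    (∀ k, E (k + 1) ≤ E k) ∧
    ∀ k, f (x k) - f xs
        - Δ₂ * Real.sqrt s / (2 * (1 - Real.sqrt (μ * s))) * ‖gradient f (x k)‖ ^ 2 ≤
      (1 - Real.sqrt (μ * s)) / (1 + Δ₁) * ((1 + Real.sqrt (μ * s)) ^ k)⁻¹ * E 0 := by
  have hdiff : Differentiable ℝ f := hf.differentiable one_ne_zero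
  have hconv : ConvexOn ℝ Set.univ f := strongConvexOn_zero.mp (hsc.mono hμ.le)
  have hsqrt : √(μ * s) = √μ * √s := Real.sqrt_mul hμ.le s
  have hmsq : √μ ^ 2 = μ := Real.sq_sqrt hμ.le
  have hm : 0 < √μ := Real.sqrt_pos.mpr hμ
  have hr : 0 < √s := Real.sqrt_pos.mpr hs
  rw [hsqrt] at hμs h1 h3
  simp only [hsqrt] at hE ⊢
  generalize √μ = m at *
  generalize √s = r at *
  have hc : 0 < 1 - m * r := by linarith
  have ha : 0 < 1 + Δ₁ := by linarith
  have hb : 0 < Δ₂ := lt_of_lt_of_le (by positivity) h2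
  have hLpos : 0 < L := one_div_pos.mp (lt_of_lt_of_le (by positivity) h1)
  have hq : 0 < 1 + m * r := by positivity
  have hstep (k : ℕ) : E (k + 1) ≤ E k := by
    have hvk : v k = ((1 + m * r) / (1 - m * r)) • v (k + 1)
        + ((r * (1 + Δ₁) + Δ₂) / (1 - m * r)) • gradient f (x (k + 1))
        - (Δ₂ / (1 - m * r)) • gradient f (x k) := by
      have h : (r / (1 - m * r)) • (r⁻¹ • (v (k + 1) - v k)) = (r / (1 - m * r)) • _ :=
        congrArg _ (hv k)
      have hc_comm : 1 - r * m ≠ 0 := by rw [mul_comm]; exact hc.ne'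
      rw [← sub_eq_zero] at h ⊢
      rw [← neg_eq_zero, ← h]
      match_scalars <;> field_simp <;> ring
    have hxk (j : ℕ) : x (j + 1) = x j + r • v j := by
      rw [← hx j, smul_inv_smul₀ hr.ne', add_sub_cancel]
    have hWk : v k + (m / (1 - m * r)) • (x (k + 1) - xs)
          + (Δ₂ / (1 - m * r)) • gradient f (x k)
        = ((1 + m * r) / (1 - m * r)) • v (k + 1) + (m / (1 - m * r)) • (x (k + 1) - xs)
          + ((r * (1 + Δ₁) + Δ₂) / (1 - m * r)) • gradient f (x (k + 1)) := by
      rw [hvk]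
      module
    have hWk' : v (k + 1) + (m / (1 - m * r)) • (x (k + 1 + 1) - xs)
          + (Δ₂ / (1 - m * r)) • gradient f (x (k + 1))
        = (1 / (1 - m * r)) • v (k + 1) + (m / (1 - m * r)) • (x (k + 1) - xs)
          + (Δ₂ / (1 - m * r)) • gradient f (x (k + 1)) := by
      rw [hxk (k + 1)]
      match_scalars <;> field_simp
      ring
    have hgap : f (x (k + 1)) - f xs ≤ ⟪gradient f (x (k + 1)), x (k + 1) - xs⟫_ℝ
        - m ^ 2 / 2 * ‖x (k + 1) - xs‖ ^ 2 := by
      have h := hsc.add_inner_gradient_add_le hdiff (x (k + 1)) xs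
      rw [← neg_sub (x (k + 1)) xs, inner_neg_right, norm_neg] at h
      rw [hmsq]
      linarith
    have hinner : 0 ≤ ⟪gradient f (x (k + 1)), x (k + 1) - xs⟫_ℝ := by
      have hy : 0 ≤ m ^ 2 / 2 * ‖x (k + 1) - xs‖ ^ 2 := by positivity
      linarith [hmin (x (k + 1))]
    have hprev := hconv.add_inner_gradient_add_norm_gradient_sub_le hdiff hLpos hL
      (x (k + 1)) (x k)
    have hdisp : x k - x (k + 1) = -(r • v k) := by
      rw [hxk k]
      abel
    have hcoef := mul_le_mul_of_nonneg_right h1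
      (sq_nonneg ‖gradient f (x k) - gradient f (x (k + 1))‖)
    rw [hdisp, hvk] at hprev
    simp only [inner_neg_right, inner_sub_right, inner_add_right, real_inner_smul_right,
      real_inner_self_eq_norm_sq, real_inner_comm (v (k + 1))] at hprev
    have henergy := symplectic_energy_step (g' := gradient f (x k)) (u := v (k + 1))
      (F' := f (x k) - f xs) hm hr hμs h2 h2' ((div_le_iff₀ hc).mp h3) hgap hinner
      (by linear_combination hprev + 1 / 2 * hcoef)
    rw [hE, hE, hWk, hWk', pow_succ, mul_assoc]
    exact mul_le_mul_of_nonneg_left henergy (by positivity)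
  refine ⟨hstep, fun k ↦ ?_⟩
  have hEk : E k ≤ E 0 := antitone_nat_of_succ_le hstep (Nat.zero_le k)
  rw [hE k] at hEk
  have hpow : 0 < (1 + m * r) ^ k := by positivity
  have hbound := (le_div_iff₀' hpow).mpr hEk
  have hdrop := (le_add_of_nonneg_right (by positivity)).trans hbound
  rw [← le_div_iff₀' (by positivity)] at hdrop
  refine hdrop.trans_eq ?_
  field_simp
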